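/- arXiv:2602.13876 — 2 statements merged into one kernel-verified Lean document; each statement's English description precedes it below -/
import Mathlib

section
/- Quantum Discrete Fourier Transform identity: for every Boolean function f : (Fin n → ZMod 2) → ZMod 2, (H^{⊗n} ⊗ I)·U_f·(|+⟩^{⊗n} ⊗ |−⟩) = Σ_{w ∈ (ZMod 2)ⁿ} c_f(w) · (e_w ⊗ |−⟩), where c_f(w) = 2^{-n} · Σ_{v} (−1)^{f(v) + v·w} is the correlation of f with the linear function v ↦ v·w. -/
open Matrix

noncomputable section

/-- The sign `(−1)^b` for `b : ZMod 2`, as a complex number. -/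
def neg1 (b : ZMod 2) : ℂ := if b = 0 then 1 else -1

/-- The sign `(−1)^b` for `b : ZMod 2`, as a real number. -/
def neg1R (b : ZMod 2) : ℝ := if b = 0 then 1 else -1

/-- The standard basis vector `e_v` of the `n`-qubit space. -/
def stdv {n : ℕ} (v : Fin n → ZMod 2) : (Fin n → ZMod 2) → ℂ :=
  Pi.single v 1

/-- The dot product `v · w` on `(ZMod 2)ⁿ`. -/
def dotZ {n : ℕ} (v w : Fin n → ZMod 2) : ZMod 2 := ∑ i, v i * w i

/-- The ket `|b⟩` for `b : ZMod 2`, an element of `ℂ²` realised as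
`ZMod 2 → ℂ`. -/
def ket (b : ZMod 2) : ZMod 2 → ℂ := Pi.single b 1

/-- The ket `|+⟩ = (|0⟩ + |1⟩)/√2`. -/
def ketP : ZMod 2 → ℂ := (1 / (Real.sqrt 2 : ℂ)) • (ket 0 + ket 1)

/-- The ket `|−⟩ = (|0⟩ − |1⟩)/√2`. -/
def ketM : ZMod 2 → ℂ := (1 / (Real.sqrt 2 : ℂ)) • (ket 0 - ket 1)

/-- The tensor product of an `n`-qubit vector with a single-qubit vector. -/
def tens {n : ℕ} (ψ : (Fin n → ZMod 2) → ℂ) (u : ZMod 2 → ℂ) :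
    ((Fin n → ZMod 2) × ZMod 2) → ℂ :=
  fun p => ψ p.1 * u p.2

/-- The state `|+⟩^{⊗n} = 2^{-n/2} Σ_v e_v`. -/
def plusN (n : ℕ) : (Fin n → ZMod 2) → ℂ :=
  (((1 / Real.sqrt 2) ^ n : ℝ) : ℂ) • ∑ v : Fin n → ZMod 2, stdv v

/-- The controlled-`f` gate `U_f`, permuting the standard basis by
`e_v ⊗ |b⟩ ↦ e_v ⊗ |b + f v⟩`. -/
def Uf {n : ℕ} (f : (Fin n → ZMod 2) → ZMod 2)
    (ψ : ((Fin n → ZMod 2) × ZMod 2) → ℂ) :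
    ((Fin n → ZMod 2) × ZMod 2) → ℂ :=
  fun p => ψ (p.1, p.2 + f p.1)

/-- The Hadamard matrix with index set `ZMod 2`; equals `(1/√2)·!![1,1;1,-1]`. -/
def H2 : Matrix (ZMod 2) (ZMod 2) ℂ :=
  Matrix.of fun a b => (1 / (Real.sqrt 2 : ℂ)) * (if a = 1 ∧ b = 1 then -1 else 1)

/-- The `n`-fold Kronecker power `H^{⊗n}`. -/
def Hpow (n : ℕ) : Matrix (Fin n → ZMod 2) (Fin n → ZMod 2) ℂ :=
  Matrix.of fun w v => ∏ i, H2 (w i) (v i)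

/-- The operator `H^{⊗n} ⊗ I` on the `(n+1)`-qubit space. -/
def HpowI (n : ℕ) :
    Matrix ((Fin n → ZMod 2) × ZMod 2) ((Fin n → ZMod 2) × ZMod 2) ℂ :=
  Matrix.of fun p q => Hpow n p.1 q.1 * (if p.2 = q.2 then 1 else 0)

/-- The correlation `c_f(w) = 2^{-n} Σ_v (−1)^{f v + v·w}` of a Boolean
function `f` with the linear function `v ↦ v·w`. -/
def corr {n : ℕ} (f : (Fin n → ZMod 2) → ZMod 2) (w : Fin n → ZMod 2) : ℝ :=
  ((2 : ℝ) ^ n)⁻¹ * ∑ v : Fin n → ZMod 2, neg1R (f v + dotZ v w)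

theorem neg1R_add (a b : ZMod 2) : neg1R (a + b) = neg1R a * neg1R b := by
  have key : ∀ a : ZMod 2, a = 0 ∨ a = 1 := by decide
  have h : (1 + 1 : ZMod 2) = 0 := by decide
  rcases key a with rfl | rfl <;> rcases key b with rfl | rfl <;> simp [neg1R, h]

theorem neg1R_sum {ι : Type*} (s : Finset ι) (g : ι → ZMod 2) :
    neg1R (∑ i ∈ s, g i) = ∏ i ∈ s, neg1R (g i) := by
  classical
  induction s using Finset.induction_on with
  | empty => simp [neg1R]
  | insert a s ha ih => rw [Finset.sum_insert ha, Finset.prod_insert ha, neg1R_add, ih]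

theorem H2_apply (a b : ZMod 2) :
    H2 a b = (1 / (Real.sqrt 2 : ℂ)) * (neg1R (b * a) : ℂ) := by
  have key : ∀ a : ZMod 2, a = 0 ∨ a = 1 := by decide
  rcases key a with rfl | rfl <;> rcases key b with rfl | rfl <;> simp [H2, neg1R]

theorem Hpow_apply {n : ℕ} (w v : Fin n → ZMod 2) :
    Hpow n w v = (1 / (Real.sqrt 2 : ℂ)) ^ n * (neg1R (dotZ v w) : ℂ) := by
  simp only [Hpow, Matrix.of_apply, H2_apply, dotZ, neg1R_sum, Finset.prod_mul_distrib,
    Finset.prod_const, Finset.card_univ, Fintype.card_fin, Complex.ofReal_prod]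

theorem plusN_apply {n : ℕ} (v : Fin n → ZMod 2) :
    plusN n v = (1 / (Real.sqrt 2 : ℂ)) ^ n := by
  simp [plusN, stdv, Finset.sum_apply, Pi.single_apply]

/-- The ket `|−⟩` is an eigenvector of every shift of the qubit (phase kickback). -/
theorem ketM_add (b c : ZMod 2) : ketM (b + c) = (neg1R c : ℂ) * ketM b := by
  have key : ∀ a : ZMod 2, a = 0 ∨ a = 1 := by decide
  have h : (1 + 1 : ZMod 2) = 0 := by decide
  rcases key b with rfl | rfl <;> rcases key c with rfl | rfl <;>
    simp [ketM, ket, neg1R, h]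

theorem HpowI_mulVec_apply {n : ℕ} (ψ : ((Fin n → ZMod 2) × ZMod 2) → ℂ)
    (w : Fin n → ZMod 2) (b : ZMod 2) :
    (HpowI n).mulVec ψ (w, b) = ∑ v, Hpow n w v * ψ (v, b) := by
  simp [Matrix.mulVec, dotProduct, HpowI, Fintype.sum_prod_type]

theorem one_div_sqrt_two_pow_mul_self (n : ℕ) :
    (1 / (Real.sqrt 2 : ℂ)) ^ n * (1 / (Real.sqrt 2 : ℂ)) ^ n = ((2 : ℂ) ^ n)⁻¹ := by
  have h : (Real.sqrt 2 : ℂ) * (Real.sqrt 2 : ℂ) = 2 := by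
    rw [← Complex.ofReal_mul, Real.mul_self_sqrt (by norm_num)]
    norm_num
  rw [← mul_pow, div_mul_div_comm, h, one_mul, one_div, inv_pow]

/-- The Quantum Discrete Fourier Transform identity:
`(H^{⊗n} ⊗ I)·U_f·(|+⟩^{⊗n} ⊗ |−⟩) = Σ_w c_f(w) (e_w ⊗ |−⟩)`. -/
theorem quantum_dft {n : ℕ} (f : (Fin n → ZMod 2) → ZMod 2) :
    (HpowI n).mulVec (Uf f (tens (plusN n) ketM))
      = ∑ w : Fin n → ZMod 2, ((corr f w : ℝ) : ℂ) • tens (stdv w) ketM := by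
  ext ⟨w, b⟩
  have hR : (∑ u : Fin n → ZMod 2, ((corr f u : ℝ) : ℂ) • tens (stdv u) ketM) (w, b)
      = (corr f w : ℂ) * ketM b := by
    simp [Finset.sum_apply, tens, stdv, Pi.single_apply]
  rw [hR, HpowI_mulVec_apply, corr]
  push_cast
  rw [Finset.mul_sum, Finset.sum_mul]
  refine Finset.sum_congr rfl fun v _ => ?_
  rw [← one_div_sqrt_two_pow_mul_self, neg1R_add, Hpow_apply]
  simp only [Uf, tens, plusN_apply, ketM_add, Complex.ofReal_mul]
  ring

end
end

section
/- GHZ stabilisers: the three-qubit cat state χ = (|0⟩⊗|0⟩⊗|0⟩ + |1⟩⊗|1⟩⊗|1⟩)/√2 satisfies (X⊗X⊗X)·χ = χ, (Z⊗Z⊗I)·χ = χ, (I⊗Z⊗Z)·χ = χ, and (X⊗Y⊗Y)·χ = −χ, (Y⊗X⊗Y)·χ = −χ, (Y⊗Y⊗X)·χ = −χ. Consequently there exist no signs x₁,x₂,x₃,y₁,y₂,y₃ ∈ {1,−1} with x₁y₂y₃ = y₁x₂y₃ = y₁y₂x₃ = −1 and x₁x₂x₃ = 1, refuting the locally realistic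 assignment of simultaneous x- and y-measurement values. -/
open Matrix Kronecker

noncomputable section

/-- The lexicographic identification of `Fin 2 × Fin 2` with `Fin 4`. -/
def e22 : Fin 2 × Fin 2 ≃ Fin 4 := finProdFinEquiv

/-- The lexicographic identification of `Fin 2 × Fin 4` with `Fin 8`. -/
def e24 : Fin 2 × Fin 4 ≃ Fin 8 := finProdFinEquiv

/-- The lexicographic identification of `Fin 2 × (Fin 2 × Fin 2)` with
`Fin 8` (first factor most significant). -/
def e222 : Fin 2 × (Fin 2 × Fin 2) ≃ Fin 8 :=
  (Equiv.prodCongr (Equiv.refl (Fin 2)) e22).trans e24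

/-- Pauli X matrix. -/
def Xm : Matrix (Fin 2) (Fin 2) ℂ := !![0, 1; 1, 0]

/-- Pauli Z matrix. -/
def Zm : Matrix (Fin 2) (Fin 2) ℂ := !![1, 0; 0, -1]

/-- Pauli Y matrix, `Y = i·X·Z`. -/
def Ym : Matrix (Fin 2) (Fin 2) ℂ := !![0, -Complex.I; Complex.I, 0]

/-- Kronecker product of three `2 × 2` matrices as an `8 × 8` matrix. -/
def kron8 (A B C : Matrix (Fin 2) (Fin 2) ℂ) : Matrix (Fin 8) (Fin 8) ℂ :=
  Matrix.reindex e222 e222 (A ⊗ₖ (B ⊗ₖ C))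

/-- Kronecker product of three vectors in `ℂ²` as a vector in `ℂ⁸`. -/
def vkron3 (u v w : Fin 2 → ℂ) : Fin 8 → ℂ :=
  fun i => u (e222.symm i).1 * v (e222.symm i).2.1 * w (e222.symm i).2.2

/-- The ket `|0⟩`. -/
def ket0 : Fin 2 → ℂ := ![1, 0]

/-- The ket `|1⟩`. -/
def ket1 : Fin 2 → ℂ := ![0, 1]

/-- The three-qubit cat state `χ = (|000⟩ + |111⟩)/√2`. -/
def cat : Fin 8 → ℂ :=
  (1 / (Real.sqrt 2 : ℂ)) • (vkron3 ket0 ket0 ket0 + vkron3 ket1 ket1 ket1)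

theorem kron8_mulVec_vkron3 (A B C : Matrix (Fin 2) (Fin 2) ℂ) (u v w : Fin 2 → ℂ) :
    (kron8 A B C).mulVec (vkron3 u v w) =
      vkron3 (A.mulVec u) (B.mulVec v) (C.mulVec w) := by
  ext i
  simp only [Matrix.mulVec, dotProduct, kron8, vkron3]
  rw [← e222.sum_comp]
  simp only [Matrix.reindex_apply, Matrix.submatrix_apply, Equiv.symm_apply_apply,
    Matrix.kroneckerMap_apply, Fintype.sum_prod_type, Fin.sum_univ_two]
  ring

theorem vkron3_smul (a b c : ℂ) (u v w : Fin 2 → ℂ) :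
    vkron3 (a • u) (b • v) (c • w) = (a * b * c) • vkron3 u v w := by
  ext i
  simp only [vkron3, Pi.smul_apply, smul_eq_mul]
  ring

/-- A product of flips acts on the cat state as a scalar if both kets pick up the same phase. -/
theorem kron8_mulVec_cat_of_flip {A B C : Matrix (Fin 2) (Fin 2) ℂ} {a b c a' b' c' s : ℂ}
    (hA : A.mulVec ket0 = a • ket1) (hB : B.mulVec ket0 = b • ket1)
    (hC : C.mulVec ket0 = c • ket1) (hA' : A.mulVec ket1 = a' • ket0)
    (hB' : B.mulVec ket1 = b' • ket0) (hC' : C.mulVec ket1 = c' • ket0)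
    (h : a * b * c = s) (h' : a' * b' * c' = s) :
    (kron8 A B C).mulVec cat = s • cat := by
  rw [cat, Matrix.mulVec_smul, Matrix.mulVec_add, kron8_mulVec_vkron3, kron8_mulVec_vkron3,
    hA, hB, hC, hA', hB', hC', vkron3_smul, vkron3_smul, h, h', ← smul_add, smul_comm, add_comm]

/-- A product of diagonal matrices acts on the cat state as a scalar if both kets pick up the
same phase. -/
theorem kron8_mulVec_cat_of_diag {A B C : Matrix (Fin 2) (Fin 2) ℂ} {a b c a' b' c' s : ℂ}
    (hA : A.mulVec ket0 = a • ket0) (hB : B.mulVec ket0 = b • ket0)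
    (hC : C.mulVec ket0 = c • ket0) (hA' : A.mulVec ket1 = a' • ket1)
    (hB' : B.mulVec ket1 = b' • ket1) (hC' : C.mulVec ket1 = c' • ket1)
    (h : a * b * c = s) (h' : a' * b' * c' = s) :
    (kron8 A B C).mulVec cat = s • cat := by
  rw [cat, Matrix.mulVec_smul, Matrix.mulVec_add, kron8_mulVec_vkron3, kron8_mulVec_vkron3,
    hA, hB, hC, hA', hB', hC', vkron3_smul, vkron3_smul, h, h', ← smul_add, smul_comm]

theorem Xm_mulVec_ket0 : Xm.mulVec ket0 = (1 : ℂ) • ket1 := by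
  ext i
  fin_cases i <;> simp [Xm, ket0, ket1]

theorem Xm_mulVec_ket1 : Xm.mulVec ket1 = (1 : ℂ) • ket0 := by
  ext i
  fin_cases i <;> simp [Xm, ket0, ket1]

theorem Ym_mulVec_ket0 : Ym.mulVec ket0 = Complex.I • ket1 := by
  ext i
  fin_cases i <;> simp [Ym, ket0, ket1]

theorem Ym_mulVec_ket1 : Ym.mulVec ket1 = (-Complex.I) • ket0 := by
  ext i
  fin_cases i <;> simp [Ym, ket0, ket1]

theorem Zm_mulVec_ket0 : Zm.mulVec ket0 = (1 : ℂ) • ket0 := by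
  ext i
  fin_cases i <;> simp [Zm, ket0]

theorem Zm_mulVec_ket1 : Zm.mulVec ket1 = (-1 : ℂ) • ket1 := by
  ext i
  fin_cases i <;> simp [Zm, ket1]

theorem one_mulVec_eq_one_smul (u : Fin 2 → ℂ) :
    (1 : Matrix (Fin 2) (Fin 2) ℂ).mulVec u = (1 : ℂ) • u := by
  rw [Matrix.one_mulVec, one_smul]

/-- The product of the four GHZ values is a square, so no sign assignment realises them. -/
theorem ghz_no_signs {x1 x2 x3 y1 y2 y3 : ℝ} (h1 : x1 * y2 * y3 = -1)
    (h2 : y1 * x2 * y3 = -1) (h3 : y1 * y2 * x3 = -1) (h : x1 * x2 * x3 = 1) : False := by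
  have key : (x1 * x2 * x3) * (y1 * y2 * y3) ^ 2 =
      (x1 * y2 * y3) * (y1 * x2 * y3) * (y1 * y2 * x3) := by ring
  rw [h, h1, h2, h3] at key
  nlinarith [sq_nonneg (y1 * y2 * y3)]

/-- GHZ stabilisers of the cat state, and the resulting refutation of locally
realistic simultaneous assignments of `x`- and `y`-measurement values. -/
theorem ghz :
    (kron8 Xm Xm Xm).mulVec cat = cat ∧
    (kron8 Zm Zm 1).mulVec cat = cat ∧
    (kron8 1 Zm Zm).mulVec cat = cat ∧
    (kron8 Xm Ym Ym).mulVec cat = -cat ∧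
    (kron8 Ym Xm Ym).mulVec cat = -cat ∧
    (kron8 Ym Ym Xm).mulVec cat = -cat ∧
    ¬ ∃ x1 x2 x3 y1 y2 y3 : ℝ,
        (x1 = 1 ∨ x1 = -1) ∧ (x2 = 1 ∨ x2 = -1) ∧ (x3 = 1 ∨ x3 = -1) ∧
        (y1 = 1 ∨ y1 = -1) ∧ (y2 = 1 ∨ y2 = -1) ∧ (y3 = 1 ∨ y3 = -1) ∧
        x1 * y2 * y3 = -1 ∧ y1 * x2 * y3 = -1 ∧ y1 * y2 * x3 = -1 ∧
        x1 * x2 * x3 = 1 := by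
  refine ⟨?_, ?_, ?_, ?_, ?_, ?_, ?_⟩
  · refine (kron8_mulVec_cat_of_flip Xm_mulVec_ket0 Xm_mulVec_ket0 Xm_mulVec_ket0
      Xm_mulVec_ket1 Xm_mulVec_ket1 Xm_mulVec_ket1 (s := 1) (by simp) (by simp)).trans ?_
    exact one_smul ℂ cat
  · refine (kron8_mulVec_cat_of_diag Zm_mulVec_ket0 Zm_mulVec_ket0 (one_mulVec_eq_one_smul _)
      Zm_mulVec_ket1 Zm_mulVec_ket1 (one_mulVec_eq_one_smul _) (s := 1) (by simp) (by simp)).trans ?_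
    exact one_smul ℂ cat
  · refine (kron8_mulVec_cat_of_diag (one_mulVec_eq_one_smul _) Zm_mulVec_ket0 Zm_mulVec_ket0
      (one_mulVec_eq_one_smul _) Zm_mulVec_ket1 Zm_mulVec_ket1 (s := 1) (by simp) (by simp)).trans ?_
    exact one_smul ℂ cat
  · refine (kron8_mulVec_cat_of_flip Xm_mulVec_ket0 Ym_mulVec_ket0 Ym_mulVec_ket0
      Xm_mulVec_ket1 Ym_mulVec_ket1 Ym_mulVec_ket1 (s := -1) (by simp) (by simp)).trans ?_
    exact neg_one_smul ℂ cat
  · refine (kron8_mulVec_cat_of_flip Ym_mulVec_ket0 Xm_mulVec_ket0 Ym_mulVec_ket0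
      Ym_mulVec_ket1 Xm_mulVec_ket1 Ym_mulVec_ket1 (s := -1) (by simp) (by simp)).trans ?_
    exact neg_one_smul ℂ cat
  · refine (kron8_mulVec_cat_of_flip Ym_mulVec_ket0 Ym_mulVec_ket0 Xm_mulVec_ket0
      Ym_mulVec_ket1 Ym_mulVec_ket1 Xm_mulVec_ket1 (s := -1) (by simp) (by simp)).trans ?_
    exact neg_one_smul ℂ cat
  · rintro ⟨x1, x2, x3, y1, y2, y3, -, -, -, -, -, -, h1, h2, h3, h⟩
    exact ghz_no_signs h1 h2 h3 h

end
end
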